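/- Fix an odd prime power q and a positive integer k. Then lim_{n→∞} #{μ ∈ 𝔜_n : v₂(d_μ) < v₂((n)_k)} / #𝔜_n = 0, where (n)_k := n(n−1)⋯(n−k+1) denotes the falling factorial and v₂ is the 2-adic valuation. -/

import Mathlib

open Filter Topology

/-- Hook lengths of a partition. -/
def hookLengths {m : ℕ} (lam : Nat.Partition m) : Multiset ℕ :=
  let L : List ℕ := (lam.parts.sort (· ≤ ·)).reverse
  (↑((List.range L.length).flatMap fun i =>
      (List.range (L.getD i 0)).map fun j =>
        (L.getD i 0 - (j + 1)) +
          ((lam.parts.filter fun p => j + 1 ≤ p).card - (i + 1)) + 1) : Multiset ℕ)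

/-- `α(λ) = Σ_i (i−1)·λ_i`, with parts in decreasing order (`1`-indexed). -/
def alphaP {m : ℕ} (lam : Nat.Partition m) : ℕ :=
  let L : List ℕ := (lam.parts.sort (· ≤ ·)).reverse
  ∑ i ∈ Finset.range L.length, i * L.getD i 0

/-- The set `Φ` of monic irreducible polynomials over `F` other than `X`. -/
def PhiSet (F : Type) [Field F] : Set (Polynomial F) :=
  {f | f.Monic ∧ Irreducible f ∧ f ≠ Polynomial.X}

/-- The reciprocal polynomial `f*(T) = f(0)⁻¹ · T^{deg f} · f(1/T)`. -/
noncomputable def fstar {F : Type} [Field F] (f : Polynomial F) : Polynomial F :=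
  Polynomial.C (f.coeff 0)⁻¹ * f.reverse

/-- The empty partition, as a partition of an arbitrary size (namely `0`). -/
def emptyPart : Σ m : ℕ, Nat.Partition m :=
  ⟨0, ⟨0, by simp, rfl⟩⟩

/-- The set `𝔛_n` of partition-valued functions `μ` on `Φ` with `Σ_f deg(f)·|μ(f)| = n`,
encoded as functions on all polynomials which are trivial outside `Φ`. -/
def XSet (F : Type) [Field F] (n : ℕ) :
    Set (Polynomial F → Σ m : ℕ, Nat.Partition m) :=
  {μ | (∀ f, f ∉ PhiSet F → μ f = emptyPart) ∧
    (∑ᶠ f : Polynomial F, f.natDegree * (μ f).1) = n}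

/-- The set `𝔜_n ⊆ 𝔛_n` of `μ` with `μ(f*) = μ(f)` for all `f ∈ Φ`. -/
def YSet (F : Type) [Field F] (n : ℕ) :
    Set (Polynomial F → Σ m : ℕ, Nat.Partition m) :=
  {μ | μ ∈ XSet F n ∧ ∀ f ∈ PhiSet F, μ (fstar f) = μ f}

/-- The degree `d_μ` of the irreducible character of `GL_n(𝔽_q)` attached to `μ` by Green's
parametrization:
`d_μ = ∏_{i=1}^n (q^i−1) · ∏_f [ q^{d(f)·α(μ(f))} / ∏_{h ∈ ℋ(μ(f))} (q^{d(f)·h} − 1) ]`. -/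
noncomputable def degGL {F : Type} [Field F] (q n : ℕ)
    (μ : Polynomial F → Σ m : ℕ, Nat.Partition m) : ℚ :=
  (∏ i ∈ Finset.Icc 1 n, ((q : ℚ) ^ i - 1)) *
    ∏ᶠ f : Polynomial F,
      ((q : ℚ) ^ (f.natDegree * alphaP (μ f).2) /
        ((hookLengths (μ f).2).map fun h => (q : ℚ) ^ (f.natDegree * h) - 1).prod)

section Valuation

theorem padicValNat_two_pow_sub_one_le {q m : ℕ} (hq : Odd q) (hq1 : 1 < q) (hm : m ≠ 0) :
    padicValNat 2 (q ^ m - 1) ≤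
      padicValNat 2 (q + 1) + padicValNat 2 (q - 1) + Nat.log 2 m := by
  have h2 : padicValNat 2 (q ^ (2 * m) - 1) + 1 =
      padicValNat 2 (q + 1) + padicValNat 2 (q - 1) + padicValNat 2 (2 * m) := by
    have := padicValNat.pow_two_sub_pow (x := q) (y := 1) (n := 2 * m) hq1
      (by obtain ⟨k, rfl⟩ := hq; simp) (by simpa [← even_iff_two_dvd] using hq)
      (by omega) (by simp)
    simpa using this
  have h3 : padicValNat 2 (2 * m) = 1 + padicValNat 2 m := by
    rw [padicValNat.mul (by norm_num) hm]; simp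
  have h4 : padicValNat 2 (q ^ m - 1) ≤ padicValNat 2 (q ^ (2 * m) - 1) := by
    have hne : q ^ (2 * m) - 1 ≠ 0 := by
      have := Nat.one_lt_pow (n := 2 * m) (by omega) hq1
      omega
    refine (padicValNat_dvd_iff_le hne).1 (pow_padicValNat_dvd.trans ?_)
    simpa using Nat.pow_sub_pow_dvd_pow_sub_pow q 1 (Dvd.intro_left 2 rfl : m ∣ 2 * m)
  have h5 := padicValNat_le_nat_log (p := 2) m
  omega

theorem one_le_padicValRat_two_pow_sub_one {q m : ℕ} (hq : Odd q) (hq1 : 1 < q) (hm : m ≠ 0) :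
    1 ≤ padicValRat 2 ((q : ℚ) ^ m - 1) := by
  have h1 := Nat.one_lt_pow hm hq1
  have : ((q : ℚ) ^ m - 1) = ((q ^ m - 1 : ℕ) : ℚ) := by
    rw [Nat.cast_sub h1.le]; simp
  rw [this, padicValRat.of_nat]
  have : 1 ≤ padicValNat 2 (q ^ m - 1) := by
    apply one_le_padicValNat_of_dvd (by omega)
    obtain ⟨k, hk⟩ := hq.pow (n := m)
    rw [hk]; simp
  exact_mod_cast this

theorem padicValRat_two_pow_sub_one_le {q m : ℕ} (hq : Odd q) (hq1 : 1 < q) (hm : m ≠ 0) :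
    padicValRat 2 ((q : ℚ) ^ m - 1) ≤
      (padicValNat 2 (q + 1) + padicValNat 2 (q - 1) + Nat.log 2 m : ℕ) := by
  have h1 := Nat.one_lt_pow hm hq1
  have : ((q : ℚ) ^ m - 1) = ((q ^ m - 1 : ℕ) : ℚ) := by
    rw [Nat.cast_sub h1.le]; simp
  rw [this, padicValRat.of_nat]
  exact_mod_cast padicValNat_two_pow_sub_one_le hq hq1 hm

theorem padicValRat_finsetProd {ι : Type*} (p : ℕ) [Fact p.Prime] (s : Finset ι) (f : ι → ℚ)
    (hf : ∀ i ∈ s, f i ≠ 0) :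
    padicValRat p (∏ i ∈ s, f i) = ∑ i ∈ s, padicValRat p (f i) := by
  classical
  induction s using Finset.induction_on with
  | empty => simp
  | insert a s ha ih =>
    rw [Finset.prod_insert ha, Finset.sum_insert ha, padicValRat.mul, ih]
    · exact fun i hi => hf i (Finset.mem_insert_of_mem hi)
    · exact hf a (Finset.mem_insert_self a s)
    · exact Finset.prod_ne_zero_iff.2 fun i hi => hf i (Finset.mem_insert_of_mem hi)

theorem padicValRat_multisetProd_le (p : ℕ) [Fact p.Prime] (s : Multiset ℚ) (c : ℕ)
    (h0 : ∀ a ∈ s, a ≠ 0) (hc : ∀ a ∈ s, padicValRat p a ≤ c) :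
    s.prod ≠ 0 ∧ padicValRat p s.prod ≤ (s.card * c : ℕ) := by
  induction s using Multiset.induction_on with
  | empty => simp
  | cons a s ih =>
    obtain ⟨h1, h2⟩ := ih (fun b hb => h0 b (Multiset.mem_cons_of_mem hb))
      (fun b hb => hc b (Multiset.mem_cons_of_mem hb))
    have ha := h0 a (Multiset.mem_cons_self a s)
    have hca := hc a (Multiset.mem_cons_self a s)
    refine ⟨by rw [Multiset.prod_cons]; exact mul_ne_zero ha h1, ?_⟩
    rw [Multiset.prod_cons, padicValRat.mul ha h1, Multiset.card_cons]
    push_cast at h2 ⊢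
    linarith

theorem padicValNat_descFactorial_le (n k : ℕ) :
    padicValNat 2 (n.descFactorial k) ≤ k * (Nat.log 2 n + 1) := by
  refine (padicValNat_le_nat_log _).trans ?_
  refine (Nat.log_mono_right (Nat.descFactorial_le_pow n k)).trans ?_
  have h : n ^ k ≤ 2 ^ (k * (Nat.log 2 n + 1)) := by
    rw [mul_comm, pow_mul]
    exact Nat.pow_le_pow_left (Nat.lt_pow_succ_log_self (by norm_num) n).le k
  simpa using Nat.log_mono_right (b := 2) h

end Valuation

section Hooks

theorem sum_range_getD (L : List ℕ) :
    ((List.range L.length).map fun i => L.getD i 0) = L := by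
  apply List.ext_getElem <;> simp +contextual

theorem card_hookLengths {m : ℕ} (lam : Nat.Partition m) : (hookLengths lam).card = m := by
  simp only [hookLengths, Multiset.coe_card, List.length_flatMap, List.length_map,
    List.length_range]
  rw [sum_range_getD]
  rw [List.sum_reverse, ← Multiset.sum_coe, Multiset.sort_eq, lam.parts_sum]

theorem Nat.Partition.card_parts_le {m : ℕ} (lam : Nat.Partition m) : lam.parts.card ≤ m := by
  have := Multiset.card_nsmul_le_sum (s := lam.parts) (a := 1) (fun x hx => lam.parts_pos hx)
  rw [lam.parts_sum] at this
  simpa using this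

theorem mem_hookLengths {m : ℕ} (lam : Nat.Partition m) {h : ℕ} (hh : h ∈ hookLengths lam) :
    1 ≤ h ∧ h ≤ 3 * m := by
  simp only [hookLengths, Multiset.mem_coe, List.mem_flatMap, List.mem_range, List.mem_map] at hh
  obtain ⟨i, hi, j, hj, rfl⟩ := hh
  set L := (lam.parts.sort (· ≤ ·)).reverse with hL
  have h1 : L.getD i 0 ∈ L := by
    rw [List.getD_eq_getElem _ _ hi]; exact List.getElem_mem hi
  have h1 : L.getD i 0 ∈ lam.parts := by simpa [hL] using h1
  have h2 := Multiset.le_sum_of_mem h1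
  rw [lam.parts_sum] at h2
  have h3 := lam.card_parts_le
  have h4 := Multiset.card_le_card (Multiset.filter_le (fun p => j + 1 ≤ p) lam.parts)
  omega

end Hooks

section Reciprocal

open Polynomial

variable {F : Type} [Field F]

theorem fstar_mul (f g : F[X]) : fstar (f * g) = fstar f * fstar g := by
  simp only [fstar, mul_coeff_zero, reverse_mul_of_domain, mul_inv, C_mul]
  ring

theorem fstar_one : fstar (1 : F[X]) = 1 := by
  have h : reverse (1 : F[X]) = 1 := by simpa using reverse_C (1 : F)
  simp [fstar, h]

theorem natDegree_fstar {f : F[X]} (h0 : f.coeff 0 ≠ 0) :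
    (fstar f).natDegree = f.natDegree := by
  rw [fstar, natDegree_C_mul (inv_ne_zero h0), reverse_natDegree,
    natTrailingDegree_eq_zero.2 (Or.inr h0), Nat.sub_zero]

theorem coeff_fstar (f : F[X]) {i : ℕ} (hi : i ≤ f.natDegree) :
    (fstar f).coeff i = (f.coeff 0)⁻¹ * f.coeff (f.natDegree - i) := by
  rw [fstar, coeff_C_mul, coeff_reverse, revAt_le hi]

theorem coeff_zero_fstar {f : F[X]} (hf : f.Monic) : (fstar f).coeff 0 = (f.coeff 0)⁻¹ := by
  rw [coeff_fstar f (Nat.zero_le _), Nat.sub_zero, hf.coeff_natDegree, mul_one]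

theorem monic_fstar {f : F[X]} (h0 : f.coeff 0 ≠ 0) : (fstar f).Monic := by
  rw [Monic, leadingCoeff, natDegree_fstar h0, coeff_fstar f le_rfl, Nat.sub_self,
    inv_mul_cancel₀ h0]

theorem fstar_fstar {f : F[X]} (hf : f.Monic) (h0 : f.coeff 0 ≠ 0) : fstar (fstar f) = f := by
  have h1 : (fstar f).coeff 0 ≠ 0 := by rw [coeff_zero_fstar hf]; exact inv_ne_zero h0
  ext i
  by_cases hi : i ≤ f.natDegree
  · rw [coeff_fstar _ (by rwa [natDegree_fstar h0]), natDegree_fstar h0,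
      coeff_fstar _ (Nat.sub_le _ _), coeff_zero_fstar hf, inv_inv, Nat.sub_sub_self hi,
      ← mul_assoc, mul_inv_cancel₀ h0, one_mul]
  · rw [coeff_eq_zero_of_natDegree_lt (by rw [natDegree_fstar h1, natDegree_fstar h0]; omega),
      coeff_eq_zero_of_natDegree_lt (by omega)]

theorem PhiSet.coeff_zero_ne_zero {f : F[X]} (hf : f ∈ PhiSet F) : f.coeff 0 ≠ 0 := by
  obtain ⟨hm, hi, hX⟩ := hf
  intro h
  exact hX (eq_of_monic_of_associated hm monic_X
    (((irreducible_X.dvd_comm hi).1 (X_dvd_iff.2 h) |> associated_of_dvd_dvd) (X_dvd_iff.2 h)))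

theorem PhiSet.natDegree_pos {f : F[X]} (hf : f ∈ PhiSet F) : 0 < f.natDegree :=
  hf.2.1.natDegree_pos

theorem PhiSet.fstar_fstar {f : F[X]} (hf : f ∈ PhiSet F) : fstar (fstar f) = f :=
  _root_.fstar_fstar hf.1 (coeff_zero_ne_zero hf)

theorem PhiSet.fstar_mem {f : F[X]} (hf : f ∈ PhiSet F) : fstar f ∈ PhiSet F := by
  have h0 := PhiSet.coeff_zero_ne_zero hf
  have h1 : (fstar f).coeff 0 ≠ 0 := by rw [coeff_zero_fstar hf.1]; exact inv_ne_zero h0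
  have hd := PhiSet.natDegree_pos hf
  refine ⟨monic_fstar h0, ⟨fun hu => ?_, fun a b hab => ?_⟩, ?_⟩
  · have := natDegree_eq_zero_of_isUnit hu
    rw [natDegree_fstar h0] at this
    omega
  · rw [hab, mul_coeff_zero] at h1
    have ha := left_ne_zero_of_mul h1
    have hb := right_ne_zero_of_mul h1
    have key : ∀ g : F[X], g.coeff 0 ≠ 0 → IsUnit (fstar g) → IsUnit g := by
      intro g hg hu
      have := natDegree_eq_zero_of_isUnit hu
      rw [natDegree_fstar hg] at this
      rw [eq_C_of_natDegree_eq_zero this]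
      exact isUnit_C.2 (isUnit_iff_ne_zero.2 hg)
    have h2 : f = fstar a * fstar b := by rw [← fstar_mul, ← hab, PhiSet.fstar_fstar hf]
    exact (hf.2.1.isUnit_or_isUnit h2).imp (key a ha) (key b hb)
  · intro h
    rw [h] at h1
    simp at h1

theorem PhiSet.eq_of_dvd {f g : F[X]} (hf : f ∈ PhiSet F) (hg : g ∈ PhiSet F) (h : f ∣ g) :
    f = g :=
  eq_of_monic_of_associated hf.1 hg.1 ((hf.2.1.dvd_irreducible_iff_associated hg.2.1).1 h)

end Reciprocal

section Orbits

open Polynomial Classical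

variable {F : Type} [Field F]

/-- A representative of the orbit `{f, f*}`. -/
noncomputable def orbitRep (f : F[X]) : F[X] :=
  Classical.epsilon fun g => g = f ∨ g = fstar f

/-- The orbit `{f, f*}`. -/
noncomputable def orbit (f : F[X]) : Finset F[X] := {f, fstar f}

/-- The product of the elements of the orbit `{f, f*}`. -/
noncomputable def orbitPoly (f : F[X]) : F[X] := ∏ g ∈ orbit f, g

theorem mem_orbit {f g : F[X]} : g ∈ orbit f ↔ g = f ∨ g = fstar f := by
  simp [orbit]

theorem orbitRep_spec (f : F[X]) : orbitRep f = f ∨ orbitRep f = fstar f :=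
  Classical.epsilon_spec (p := fun g => g = f ∨ g = fstar f) ⟨f, Or.inl rfl⟩

theorem orbitRep_fstar {f : F[X]} (hf : f ∈ PhiSet F) : orbitRep (fstar f) = orbitRep f := by
  rw [orbitRep, orbitRep, (PhiSet.fstar_fstar hf)]
  congr 1
  ext g
  exact or_comm

theorem orbitRep_mem {f : F[X]} (hf : f ∈ PhiSet F) : orbitRep f ∈ PhiSet F := by
  rcases orbitRep_spec f with h | h <;> rw [h]
  exacts [hf, PhiSet.fstar_mem hf]

theorem orbitRep_orbitRep {f : F[X]} (hf : f ∈ PhiSet F) :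
    orbitRep (orbitRep f) = orbitRep f := by
  rcases orbitRep_spec f with h | h
  · rw [h, h]
  · exact (congrArg orbitRep h).trans (orbitRep_fstar hf)

theorem mem_orbit_iff_orbitRep_eq {f r : F[X]} (hf : f ∈ PhiSet F) (hr : r ∈ PhiSet F)
    (hrep : orbitRep r = r) : f ∈ orbit r ↔ orbitRep f = r := by
  rw [mem_orbit]
  constructor
  · rintro (rfl | rfl)
    · exact hrep
    · rw [orbitRep_fstar hr, hrep]
  · intro h
    rcases orbitRep_spec f with h' | h'
    · left; rw [← h', h]
    · right; rw [← h, h', (PhiSet.fstar_fstar hf)]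

theorem mem_PhiSet_of_mem_orbit {f r : F[X]} (hr : r ∈ PhiSet F) (hf : f ∈ orbit r) :
    f ∈ PhiSet F := by
  rcases mem_orbit.1 hf with rfl | rfl
  exacts [hr, PhiSet.fstar_mem hr]

theorem natDegree_of_mem_orbit {f r : F[X]} (hr : r ∈ PhiSet F) (hf : f ∈ orbit r) :
    f.natDegree = r.natDegree := by
  rcases mem_orbit.1 hf with rfl | rfl
  exacts [rfl, natDegree_fstar (PhiSet.coeff_zero_ne_zero hr)]

theorem fstar_orbitPoly {r : F[X]} (hr : r ∈ PhiSet F) : fstar (orbitPoly r) = orbitPoly r := by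
  by_cases h : r = fstar r
  · simp [orbitPoly, orbit, ← h]
  · rw [orbitPoly, orbit, Finset.prod_pair h, fstar_mul, (PhiSet.fstar_fstar hr), mul_comm]

theorem monic_orbitPoly {r : F[X]} (hr : r ∈ PhiSet F) : (orbitPoly r).Monic :=
  monic_prod_of_monic _ _ fun _ hf => (mem_PhiSet_of_mem_orbit hr hf).1

theorem coeff_zero_orbitPoly {r : F[X]} (hr : r ∈ PhiSet F) : (orbitPoly r).coeff 0 ≠ 0 := by
  rw [orbitPoly, coeff_zero_prod]
  exact Finset.prod_ne_zero_iff.2 fun _ hf =>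
    PhiSet.coeff_zero_ne_zero (mem_PhiSet_of_mem_orbit hr hf)

theorem natDegree_orbitPoly {r : F[X]} (hr : r ∈ PhiSet F) :
    (orbitPoly r).natDegree = ∑ f ∈ orbit r, f.natDegree :=
  natDegree_prod_of_monic _ _ fun _ hf => (mem_PhiSet_of_mem_orbit hr hf).1

theorem card_orbit_le (r : F[X]) : (orbit r).card ≤ 2 := Finset.card_le_two

theorem dvd_orbitPoly_iff {f r : F[X]} (hf : f ∈ PhiSet F) (hr : r ∈ PhiSet F) :
    f ∣ orbitPoly r ↔ f ∈ orbit r := by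
  constructor
  · intro h
    obtain ⟨g, hg, hfg⟩ := (hf.2.1.prime.dvd_finsetProd_iff _).1 h
    rwa [PhiSet.eq_of_dvd hf (mem_PhiSet_of_mem_orbit hr hg) hfg]
  · exact fun h => Finset.dvd_prod_of_mem _ h

theorem eq_of_dvd_orbitPoly {r s : F[X]} (hr : r ∈ PhiSet F) (hs : s ∈ PhiSet F)
    (hr' : orbitRep r = r) (hs' : orbitRep s = s) (h : r ∣ orbitPoly s) : r = s := by
  rw [← hr', ← mem_orbit_iff_orbitRep_eq hr hs hs']
  exact (dvd_orbitPoly_iff hr hs).1 h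

theorem dvd_orbitPoly_self (r : F[X]) : r ∣ orbitPoly r :=
  Finset.dvd_prod_of_mem _ (mem_orbit.2 (Or.inl rfl))

variable [Finite F]

theorem finite_natDegree_le (n : ℕ) : {f : F[X] | f.natDegree ≤ n}.Finite := by
  refine Set.Finite.of_finite_image (f := fun f : F[X] => fun i : Fin (n + 1) => f.coeff i)
    (Set.toFinite _) ?_
  intro f hf g hg h
  ext i
  by_cases hi : i < n + 1
  · exact congrFun h ⟨i, hi⟩
  · rw [coeff_eq_zero_of_natDegree_lt (lt_of_le_of_lt hf (by omega)),
      coeff_eq_zero_of_natDegree_lt (lt_of_le_of_lt hg (by omega))]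

variable (F) in
/-- The elements of `Φ` of degree at most `n`. -/
noncomputable def PhiFin (n : ℕ) : Finset F[X] :=
  ((finite_natDegree_le (F := F) n).subset
    (fun _ hf => hf.2 : {f : F[X] | f ∈ PhiSet F ∧ f.natDegree ≤ n} ⊆ _)).toFinset

variable (F) in
/-- Representatives of the orbits `{f, f*}` of elements of `Φ` of degree at most `n`. -/
noncomputable def orbitReps (n : ℕ) : Finset F[X] := (PhiFin F n).image orbitRep

theorem mem_PhiFin {n : ℕ} {f : F[X]} : f ∈ PhiFin F n ↔ f ∈ PhiSet F ∧ f.natDegree ≤ n := by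
  simp [PhiFin]

theorem mem_orbitReps {n : ℕ} {r : F[X]} :
    r ∈ orbitReps F n ↔ r ∈ PhiSet F ∧ r.natDegree ≤ n ∧ orbitRep r = r := by
  simp only [orbitReps, Finset.mem_image, mem_PhiFin]
  constructor
  · rintro ⟨f, ⟨hf, hn⟩, rfl⟩
    refine ⟨orbitRep_mem hf, ?_, orbitRep_orbitRep hf⟩
    rwa [natDegree_of_mem_orbit hf (mem_orbit.2 (orbitRep_spec f))]
  · rintro ⟨h1, h2, h3⟩
    exact ⟨r, ⟨h1, h2⟩, h3⟩

theorem orbitRep_mem_orbitReps {n : ℕ} {f : F[X]} (hf : f ∈ PhiFin F n) :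
    orbitRep f ∈ orbitReps F n :=
  Finset.mem_image_of_mem _ hf

theorem prod_PhiFin_eq_prod_orbitReps {M : Type*} [CommMonoid M] (n : ℕ) (G : F[X] → M) :
    ∏ f ∈ PhiFin F n, G f = ∏ r ∈ orbitReps F n, ∏ f ∈ orbit r, G f := by
  rw [← Finset.prod_fiberwise_of_maps_to
    (fun f hf => orbitRep_mem_orbitReps hf)]
  refine Finset.prod_congr rfl fun r hr => Finset.prod_congr ?_ fun _ _ => rfl
  obtain ⟨h1, h2, h3⟩ := mem_orbitReps.1 hr
  ext f
  rw [Finset.mem_filter, mem_PhiFin]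
  constructor
  · rintro ⟨⟨hf, -⟩, h⟩
    exact (mem_orbit_iff_orbitRep_eq hf h1 h3).2 h
  · intro hf
    have hf' := mem_PhiSet_of_mem_orbit h1 hf
    exact ⟨⟨hf', by rwa [natDegree_of_mem_orbit h1 hf]⟩,
      (mem_orbit_iff_orbitRep_eq hf' h1 h3).1 hf⟩

variable (F) in
/-- The monic self-reciprocal polynomials of degree at most `n`. -/
noncomputable def selfRecip (n : ℕ) : Finset F[X] :=
  ((finite_natDegree_le (F := F) n).subset
    (fun _ hf => hf.2 : {f : F[X] | (f.Monic ∧ f.coeff 0 ≠ 0 ∧ fstar f = f) ∧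
      f.natDegree ≤ n} ⊆ _)).toFinset

theorem mem_selfRecip {n : ℕ} {f : F[X]} : f ∈ selfRecip F n ↔
    (f.Monic ∧ f.coeff 0 ≠ 0 ∧ fstar f = f) ∧ f.natDegree ≤ n := by
  simp [selfRecip]

theorem card_selfRecip_natDegree_le (n e : ℕ) :
    ((selfRecip F n).filter fun g => g.natDegree = e).card ≤ Nat.card F ^ (e / 2 + 1) := by
  have : Fintype F := Fintype.ofFinite F
  have hc : Nat.card F ^ (e / 2 + 1) =
      (Finset.univ : Finset (Fin (e / 2 + 1) → F)).card := by
    simp [Nat.card_eq_fintype_card]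
  rw [hc]
  refine Finset.card_le_card_of_injOn (fun g i => g.coeff i) (fun _ _ => Finset.mem_univ _) ?_
  intro f hf g hg h
  simp only [Finset.coe_filter, Set.mem_ofPred_eq, mem_selfRecip] at hf hg
  obtain ⟨⟨⟨hf1, hf2, hf3⟩, -⟩, hfe⟩ := hf
  obtain ⟨⟨⟨hg1, hg2, hg3⟩, -⟩, hge⟩ := hg
  have hlow : ∀ i ≤ e / 2, f.coeff i = g.coeff i := fun i hi =>
    congrFun h ⟨i, Nat.lt_succ_of_le hi⟩
  ext i
  by_cases hi : i ≤ e
  · by_cases hi2 : i ≤ e / 2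
    · exact hlow i hi2
    · rw [← hf3, ← hg3, coeff_fstar _ (by omega), coeff_fstar _ (by omega), hfe, hge,
        hlow 0 (by omega), hlow (e - i) (by omega)]
  · rw [coeff_eq_zero_of_natDegree_lt (by omega), coeff_eq_zero_of_natDegree_lt (by omega)]

theorem sum_selfRecip_le (n : ℕ) {u : ℝ} (hu0 : 0 ≤ u) (hu : u ^ 2 * Nat.card F = 1)
    (hu1 : u ≤ 1) :
    ∑ g ∈ selfRecip F n, u ^ g.natDegree ≤ (n + 1) * Nat.card F := by
  rw [← Finset.sum_fiberwise_of_maps_to (t := Finset.range (n + 1))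
    (g := fun g : F[X] => g.natDegree)
    (fun g hg => Finset.mem_range.2 (Nat.lt_succ_of_le (mem_selfRecip.1 hg).2))]
  calc _ ≤ ∑ e ∈ Finset.range (n + 1), (Nat.card F : ℝ) := by
        refine Finset.sum_le_sum fun e _ => ?_
        rw [Finset.sum_congr rfl (g := fun _ => u ^ e)
          (fun g hg => by rw [(Finset.mem_filter.1 hg).2])]
        rw [Finset.sum_const, nsmul_eq_mul]
        calc _ ≤ ((Nat.card F ^ (e / 2 + 1) : ℕ) : ℝ) * u ^ e := by
              gcongr
              exact card_selfRecip_natDegree_le n e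
          _ = (u ^ 2 * Nat.card F) ^ (e / 2) * u ^ (e % 2) * Nat.card F := by
              conv_lhs => rw [← Nat.div_add_mod e 2]
              rw [show (2 * (e / 2) + e % 2) / 2 = e / 2 by omega, pow_add u, pow_mul u]
              push_cast
              ring
          _ ≤ Nat.card F := by
              rw [hu, one_pow, one_mul]
              exact mul_le_of_le_one_left (by positivity) (pow_le_one₀ hu0 hu1)
    _ = _ := by simp

theorem card_pairs_orbitPoly_le (n : ℕ) (g : F[X]) :
    ((orbitReps F n ×ˢ orbitReps F n).filter
      fun p => orbitPoly p.1 * orbitPoly p.2 = g).card ≤ 2 := by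
  by_cases h : ((orbitReps F n ×ˢ orbitReps F n).filter
      fun p => orbitPoly p.1 * orbitPoly p.2 = g) = ∅
  · rw [h]; simp
  obtain ⟨⟨a, b⟩, hab⟩ := Finset.nonempty_iff_ne_empty.2 h
  refine (Finset.card_le_card (t := {(a, b), (b, a)}) ?_).trans Finset.card_le_two
  rintro ⟨c, d⟩ hcd
  simp only [Finset.mem_filter, Finset.mem_product] at hab hcd
  obtain ⟨⟨ha, hb⟩, hg⟩ := hab
  obtain ⟨⟨hc, hd⟩, hg'⟩ := hcd
  rw [mem_orbitReps] at ha hb hc hd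
  rw [← hg] at hg'
  have hdvd : c ∣ orbitPoly a * orbitPoly b :=
    hg' ▸ (dvd_orbitPoly_self c).mul_right _
  simp only [Finset.mem_insert, Finset.mem_singleton, Prod.mk.injEq]
  rcases hc.1.2.1.prime.dvd_or_dvd hdvd with h1 | h1
  · have hca := eq_of_dvd_orbitPoly hc.1 ha.1 hc.2.2 ha.2.2 h1
    subst hca
    have := mul_left_cancel₀ (monic_orbitPoly hc.1).ne_zero hg'
    exact Or.inl ⟨rfl, eq_of_dvd_orbitPoly hd.1 hb.1 hd.2.2 hb.2.2
      (this ▸ dvd_orbitPoly_self d)⟩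
  · have hcb := eq_of_dvd_orbitPoly hc.1 hb.1 hc.2.2 hb.2.2 h1
    subst hcb
    rw [mul_comm (orbitPoly a)] at hg'
    have := mul_left_cancel₀ (monic_orbitPoly hc.1).ne_zero hg'
    exact Or.inr ⟨rfl, eq_of_dvd_orbitPoly hd.1 ha.1 hd.2.2 ha.2.2
      (this ▸ dvd_orbitPoly_self d)⟩

theorem natDegree_orbitPoly_le {n : ℕ} {r : F[X]} (hr : r ∈ orbitReps F n) :
    (orbitPoly r).natDegree ≤ 2 * n := by
  obtain ⟨h1, h2, -⟩ := mem_orbitReps.1 hr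
  rw [natDegree_orbitPoly h1]
  calc _ ≤ (orbit r).card • n := Finset.sum_le_card_nsmul _ _ _ fun f hf => by
        rwa [natDegree_of_mem_orbit h1 hf]
    _ ≤ 2 * n := by
        rw [smul_eq_mul]
        exact Nat.mul_le_mul_right _ (card_orbit_le r)

theorem sum_orbitReps_sq_le (n : ℕ) {u : ℝ} (hu0 : 0 ≤ u) (hu : u ^ 2 * Nat.card F = 1)
    (hu1 : u ≤ 1) :
    (∑ r ∈ orbitReps F n, u ^ (orbitPoly r).natDegree) ^ 2 ≤
      2 * ((4 * n + 1) * Nat.card F) := by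
  have hmaps : ∀ p ∈ orbitReps F n ×ˢ orbitReps F n,
      orbitPoly p.1 * orbitPoly p.2 ∈ selfRecip F (4 * n) := by
    rintro ⟨a, b⟩ hab
    obtain ⟨ha, hb⟩ := Finset.mem_product.1 hab
    have h1 := natDegree_orbitPoly_le ha
    have h2 := natDegree_orbitPoly_le hb
    have ha' := (mem_orbitReps.1 ha).1
    have hb' := (mem_orbitReps.1 hb).1
    refine mem_selfRecip.2 ⟨⟨(monic_orbitPoly ha').mul (monic_orbitPoly hb'), ?_, ?_⟩, ?_⟩
    · rw [mul_coeff_zero]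
      exact mul_ne_zero (coeff_zero_orbitPoly ha') (coeff_zero_orbitPoly hb')
    · rw [fstar_mul, fstar_orbitPoly ha', fstar_orbitPoly hb']
    · rw [(monic_orbitPoly ha').natDegree_mul (monic_orbitPoly hb')]
      dsimp only at h1 h2 ⊢
      omega
  calc (∑ r ∈ orbitReps F n, u ^ (orbitPoly r).natDegree) ^ 2
      = ∑ p ∈ orbitReps F n ×ˢ orbitReps F n,
          u ^ (orbitPoly p.1 * orbitPoly p.2).natDegree := by
        rw [sq, Finset.sum_mul_sum, ← Finset.sum_product']
        refine Finset.sum_congr rfl fun p hp => ?_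
        obtain ⟨ha, hb⟩ := Finset.mem_product.1 hp
        rw [(monic_orbitPoly (mem_orbitReps.1 ha).1).natDegree_mul
          (monic_orbitPoly (mem_orbitReps.1 hb).1), pow_add]
    _ = ∑ g ∈ selfRecip F (4 * n), ∑ p ∈ (orbitReps F n ×ˢ orbitReps F n).filter
          (fun p => orbitPoly p.1 * orbitPoly p.2 = g),
            u ^ (orbitPoly p.1 * orbitPoly p.2).natDegree :=
        (Finset.sum_fiberwise_of_maps_to hmaps _).symm
    _ ≤ ∑ g ∈ selfRecip F (4 * n), 2 * u ^ g.natDegree := by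
        refine Finset.sum_le_sum fun g _ => ?_
        rw [Finset.sum_congr rfl (g := fun _ => u ^ g.natDegree)
          (fun p hp => by rw [(Finset.mem_filter.1 hp).2]), Finset.sum_const, nsmul_eq_mul]
        gcongr
        exact_mod_cast card_pairs_orbitPoly_le n g
    _ ≤ _ := by
        rw [← Finset.mul_sum]
        have := sum_selfRecip_le (F := F) (4 * n) hu0 hu hu1
        push_cast at this
        linarith

end Orbits

section Encoding

open Polynomial

theorem sigma_partition_ext {x y : Σ m : ℕ, Nat.Partition m} (h : x.2.parts = y.2.parts) :
    x = y := by
  obtain ⟨m, x⟩ := x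
  obtain ⟨k, y⟩ := y
  obtain rfl : m = k := by rw [← x.parts_sum, ← y.parts_sum]; exact congrArg _ h
  exact congrArg _ (Nat.Partition.ext h)

theorem eq_emptyPart {x : Σ m : ℕ, Nat.Partition m} (h : x.1 = 0) : x = emptyPart := by
  apply sigma_partition_ext
  have h2 : x.2.parts.card = 0 := Nat.le_zero.1 (x.2.card_parts_le.trans_eq h)
  rw [Multiset.card_eq_zero.1 h2]
  rfl

theorem Nat.Partition.sum_succ_mul_count {m n : ℕ} (lam : Nat.Partition m) (h : m ≤ n) :
    ∑ i : Fin n, ((i : ℕ) + 1) * lam.parts.count ((i : ℕ) + 1) = m := by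
  conv_rhs => rw [← lam.parts_sum]
  rw [Finset.sum_multiset_count_of_subset lam.parts (Finset.range (n + 1)),
    Finset.sum_range_succ', Fin.sum_univ_eq_sum_range
      (fun i => (i + 1) * lam.parts.count (i + 1)) n]
  · simp [mul_comm]
  · intro a ha
    have := Multiset.le_sum_of_mem (Multiset.mem_toFinset.1 ha)
    rw [lam.parts_sum] at this
    exact Finset.mem_range.2 (by omega)

theorem natCard_mul_le_prod_inv {T ι : Type*} [Fintype ι] (n : ℕ) (w : ι → ℝ)
    (hw0 : ∀ i, 0 ≤ w i) (hw1 : ∀ i, w i < 1) (c : T → ι → ℕ) (hinj : Function.Injective c)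
    (hc : ∀ t i, c t i ≤ n) (A : ℝ) (hA : ∀ t, A ≤ ∏ i, w i ^ c t i) :
    Nat.card T * A ≤ ∏ i, (1 - w i)⁻¹ := by
  classical
  have hmem : ∀ t, c t ∈ Fintype.piFinset fun _ : ι => Finset.range (n + 1) := fun t =>
    Fintype.mem_piFinset.2 fun i => Finset.mem_range.2 (Nat.lt_succ_of_le (hc t i))
  have : Finite T := Finite.of_injective
    (fun t => (⟨c t, hmem t⟩ : ↥(Fintype.piFinset fun _ : ι => Finset.range (n + 1))))
    fun a b h => hinj (congrArg Subtype.val h)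
  have : Fintype T := Fintype.ofFinite T
  calc Nat.card T * A = ∑ _t : T, A := by
        simp [Nat.card_eq_fintype_card]
    _ ≤ ∑ t : T, ∏ i, w i ^ c t i := Finset.sum_le_sum fun t _ => hA t
    _ = ∑ p ∈ Finset.univ.image c, ∏ i, w i ^ p i := by
        rw [Finset.sum_image fun _ _ _ _ h => hinj h]
    _ ≤ ∑ p ∈ Fintype.piFinset fun _ : ι => Finset.range (n + 1), ∏ i, w i ^ p i := by
        refine Finset.sum_le_sum_of_subset_of_nonneg ?_ fun p _ _ =>
          Finset.prod_nonneg fun i _ => pow_nonneg (hw0 i) _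
        intro p hp
        obtain ⟨t, -, rfl⟩ := Finset.mem_image.1 hp
        exact hmem t
    _ = ∏ i, ∑ m ∈ Finset.range (n + 1), w i ^ m :=
        (Finset.prod_univ_sum (fun _ : ι => Finset.range (n + 1)) fun i m => w i ^ m).symm
    _ ≤ ∏ i, (1 - w i)⁻¹ := by
        refine Finset.prod_le_prod (fun i _ => Finset.sum_nonneg fun m _ => pow_nonneg (hw0 i) _)
          fun i _ => ?_
        rw [← tsum_geometric_of_lt_one (hw0 i) (hw1 i)]
        exact (summable_geometric_of_lt_one (hw0 i) (hw1 i)).sum_le_tsum _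
          fun m _ => pow_nonneg (hw0 i) _

theorem prod_one_sub_pow_inv_le (n : ℕ) {t : ℝ} (h0 : 0 ≤ t) (h1 : t ≤ 7 / 8) :
    ∏ i : Fin n, (1 - t ^ ((i : ℕ) + 1))⁻¹ ≤ Real.exp (64 * t) := by
  have hy : ∀ i : ℕ, t ^ (i + 1) ≤ 7 / 8 := fun i =>
    (pow_le_of_le_one h0 (by linarith) (Nat.succ_ne_zero i)).trans h1
  have hterm : ∀ i : ℕ, (1 - t ^ (i + 1))⁻¹ ≤ Real.exp (8 * t ^ (i + 1)) := by
    intro i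
    have hy0 : 0 ≤ t ^ (i + 1) := pow_nonneg h0 _
    have hy1 := hy i
    refine le_trans ?_ (Real.add_one_le_exp _)
    rw [inv_le_iff_one_le_mul₀ (by linarith)]
    nlinarith
  calc _ ≤ ∏ i : Fin n, Real.exp (8 * t ^ ((i : ℕ) + 1)) :=
        Finset.prod_le_prod (fun i _ => inv_nonneg.2 (by linarith [hy i])) fun i _ => hterm i
    _ = Real.exp (8 * t * ∑ i ∈ Finset.range n, t ^ i) := by
        rw [← Real.exp_sum, Fin.sum_univ_eq_sum_range (fun i => 8 * t ^ (i + 1)), Finset.mul_sum]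
        congr 1
        exact Finset.sum_congr rfl fun i _ => by ring
    _ ≤ Real.exp (64 * t) := by
        refine Real.exp_le_exp.2 ?_
        have h2 : ∑ i ∈ Finset.range n, t ^ i ≤ (1 - t)⁻¹ := by
          rw [← tsum_geometric_of_lt_one h0 (by linarith)]
          exact (summable_geometric_of_lt_one h0 (by linarith)).sum_le_tsum _
            fun m _ => pow_nonneg h0 _
        have h3 : (1 - t)⁻¹ ≤ 8 := by
          rw [inv_le_iff_one_le_mul₀ (by linarith)]; linarith
        nlinarith

variable {F : Type} [Field F] {n : ℕ} {μ : F[X] → Σ m : ℕ, Nat.Partition m}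

theorem XSet.finite_support (hn : n ≠ 0) (hμ : μ ∈ XSet F n) :
    (Function.support fun f : F[X] => f.natDegree * (μ f).1).Finite := by
  by_contra h
  exact hn (hμ.2 ▸ finsum_of_infinite_support h)

theorem XSet.natDegree_mul_le (hn : n ≠ 0) (hμ : μ ∈ XSet F n) (f : F[X]) :
    f.natDegree * (μ f).1 ≤ n := by
  rw [← hμ.2]
  exact single_le_finsum f (XSet.finite_support hn hμ) fun _ => Nat.zero_le _

theorem YSet.apply_eq_of_mem_orbit (hμ : μ ∈ YSet F n) {f r : F[X]} (hr : r ∈ PhiSet F)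
    (hf : f ∈ orbit r) : μ f = μ r := by
  rcases mem_orbit.1 hf with rfl | rfl
  exacts [rfl, hμ.2 r hr]

theorem prod_orbit_le {u : ℝ} (hu0 : 0 ≤ u) (hu : 3 / 2 * u ≤ 7 / 8) {r : F[X]}
    (hr : r ∈ PhiSet F) : ∏ f ∈ orbit r, 3 / 2 * u ^ f.natDegree ≤ 7 / 8 := by
  classical
  have hle : ∀ f ∈ orbit r, 3 / 2 * u ^ f.natDegree ≤ 7 / 8 := by
    intro f hf
    have hd := PhiSet.natDegree_pos (mem_PhiSet_of_mem_orbit hr hf)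
    have := pow_le_of_le_one hu0 (by linarith) hd.ne'
    linarith
  have hmem : r ∈ orbit r := mem_orbit.2 (Or.inl rfl)
  rw [← Finset.mul_prod_erase _ _ hmem]
  refine (mul_le_of_le_one_right (by positivity) ?_).trans (hle r hmem)
  exact Finset.prod_le_one (fun f _ => by positivity) fun f hf =>
    (hle f (Finset.mem_of_mem_erase hf)).trans (by norm_num)

theorem prod_orbit_le_mul_pow {u : ℝ} (hu0 : 0 ≤ u) {r : F[X]} (hr : r ∈ PhiSet F) :
    ∏ f ∈ orbit r, 3 / 2 * u ^ f.natDegree ≤ 9 / 4 * u ^ (orbitPoly r).natDegree := by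
  rw [natDegree_orbitPoly hr, ← Finset.prod_pow_eq_pow_sum, Finset.prod_mul_distrib,
    Finset.prod_const]
  gcongr
  exact (pow_le_pow_right₀ (by norm_num) (card_orbit_le r)).trans (by norm_num)

variable [Finite F]

theorem XSet.eq_emptyPart_of_notMem (hn : n ≠ 0) (hμ : μ ∈ XSet F n) {f : F[X]}
    (hf : f ∉ PhiFin F n) : μ f = emptyPart := by
  by_cases hf' : f ∈ PhiSet F
  · rw [mem_PhiFin] at hf
    have h1 := XSet.natDegree_mul_le hn hμ f
    have h2 : n < f.natDegree := by
      by_contra h; exact hf ⟨hf', by omega⟩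
    apply eq_emptyPart
    by_contra h
    have := Nat.le_mul_of_pos_right f.natDegree (Nat.pos_of_ne_zero h)
    omega
  · exact hμ.1 f hf'

theorem XSet.size_le (hn : n ≠ 0) (hμ : μ ∈ XSet F n) (f : F[X]) : (μ f).1 ≤ n := by
  by_cases hf : f ∈ PhiFin F n
  · exact (Nat.le_mul_of_pos_left _ (PhiSet.natDegree_pos (mem_PhiFin.1 hf).1)).trans
      (XSet.natDegree_mul_le hn hμ f)
  · rw [XSet.eq_emptyPart_of_notMem hn hμ hf]
    exact Nat.zero_le _

theorem XSet.sum_natDegree_mul (hn : n ≠ 0) (hμ : μ ∈ XSet F n) :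
    ∑ f ∈ PhiFin F n, f.natDegree * (μ f).1 = n := by
  conv_rhs => rw [← hμ.2]
  refine (finsum_eq_sum_of_support_subset _ ?_).symm
  intro f hf
  by_contra h
  refine hf ?_
  dsimp only
  rw [XSet.eq_emptyPart_of_notMem hn hμ h]
  exact Nat.mul_zero _

/-- The number of irreducible factors, counted with multiplicity, of `∏_f f ^ |μ(f)|`. -/
noncomputable def numFactors (n : ℕ) (μ : F[X] → Σ m : ℕ, Nat.Partition m) : ℕ :=
  ∑ f ∈ PhiFin F n, (μ f).1

/-- The multiplicities of the parts of the partitions `μ(r)`, for `r` a representative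
of an orbit `{f, f*}`. -/
noncomputable def partCounts (n : ℕ) (μ : F[X] → Σ m : ℕ, Nat.Partition m)
    (p : ↥(orbitReps F n) × Fin n) : ℕ :=
  (μ p.1).2.parts.count ((p.2 : ℕ) + 1)

theorem partCounts_injOn (hn : n ≠ 0) :
    Set.InjOn (partCounts (F := F) n) (YSet F n) := by
  intro μ hμ ν hν h
  have hrep : ∀ r ∈ orbitReps F n, μ r = ν r := by
    intro r hr
    apply sigma_partition_ext
    ext a
    by_cases ha : 1 ≤ a ∧ a ≤ n
    · have := congrFun h (⟨r, hr⟩, ⟨a - 1, by omega⟩)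
      simpa [partCounts, Nat.sub_add_cancel ha.1] using this
    · have key : ∀ ρ ∈ YSet F n, (ρ r).2.parts.count a = 0 := by
        intro ρ hρ
        refine Multiset.count_eq_zero.2 fun hmem => ha ⟨(ρ r).2.parts_pos hmem, ?_⟩
        have h1 := Multiset.le_sum_of_mem hmem
        rw [(ρ r).2.parts_sum] at h1
        exact h1.trans (XSet.size_le hn hρ.1 r)
      rw [key μ hμ, key ν hν]
  funext f
  by_cases hf : f ∈ PhiFin F n
  · obtain ⟨hf1, hf2⟩ := mem_PhiFin.1 hf
    have hr : orbitRep f ∈ orbitReps F n := orbitRep_mem_orbitReps hf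
    obtain ⟨hr1, -, hr3⟩ := mem_orbitReps.1 hr
    have hmem := (mem_orbit_iff_orbitRep_eq hf1 hr1 hr3).2 rfl
    rw [YSet.apply_eq_of_mem_orbit hμ hr1 hmem, YSet.apply_eq_of_mem_orbit hν hr1 hmem,
      hrep _ hr]
  · rw [XSet.eq_emptyPart_of_notMem hn hμ.1 hf, XSet.eq_emptyPart_of_notMem hn hν.1 hf]

theorem prod_pow_partCounts (hn : n ≠ 0) (hμ : μ ∈ YSet F n) (x u : ℝ) :
    ∏ p : ↥(orbitReps F n) × Fin n,
      ((∏ f ∈ orbit (p.1 : F[X]), x * u ^ f.natDegree) ^ ((p.2 : ℕ) + 1)) ^ partCounts n μ p =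
        x ^ numFactors n μ * u ^ n := by
  rw [Fintype.prod_prod_type]
  calc _ = ∏ r : ↥(orbitReps F n), ∏ f ∈ orbit (r : F[X]), (x * u ^ f.natDegree) ^ (μ f).1 := by
        refine Finset.prod_congr rfl fun r _ => ?_
        have hr := (mem_orbitReps.1 r.2).1
        simp only [← pow_mul, partCounts]
        rw [Finset.prod_pow_eq_pow_sum,
          Nat.Partition.sum_succ_mul_count _ (XSet.size_le hn hμ.1 _), ← Finset.prod_pow]
        exact Finset.prod_congr rfl fun f hf => by
          rw [YSet.apply_eq_of_mem_orbit hμ hr hf]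
    _ = ∏ f ∈ PhiFin F n, (x * u ^ f.natDegree) ^ (μ f).1 := by
        rw [prod_PhiFin_eq_prod_orbitReps]
        exact Finset.prod_coe_sort (orbitReps F n)
          fun r => ∏ f ∈ orbit r, (x * u ^ f.natDegree) ^ (μ f).1
    _ = _ := by
        simp only [mul_pow, ← pow_mul]
        rw [Finset.prod_mul_distrib, Finset.prod_pow_eq_pow_sum, Finset.prod_pow_eq_pow_sum,
          XSet.sum_natDegree_mul hn hμ.1, numFactors]

theorem natCard_numFactors_ge_le (hn : n ≠ 0) (hF : 3 ≤ Nat.card F) {u : ℝ} (hu0 : 0 ≤ u)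
    (hu : u ^ 2 * Nat.card F = 1) (T : Set (F[X] → Σ m : ℕ, Nat.Partition m)) (hT : T ⊆ YSet F n)
    (K : ℕ) (hK : ∀ μ ∈ T, K ≤ numFactors n μ) :
    Nat.card T * ((3 / 2) ^ K * u ^ n) ≤
      Real.exp (144 * ∑ r ∈ orbitReps F n, u ^ (orbitPoly r).natDegree) := by
  have hF' : (3 : ℝ) ≤ Nat.card F := by exact_mod_cast hF
  have hxu : 3 / 2 * u ≤ 7 / 8 := by
    by_contra h
    nlinarith [sq_nonneg u]
  obtain ⟨t, ht⟩ : ∃ t : F[X] → ℝ, ∀ r, t r = ∏ f ∈ orbit r, 3 / 2 * u ^ f.natDegree :=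
    ⟨_, fun _ => rfl⟩
  have ht0 : ∀ r, 0 ≤ t r := fun r => ht r ▸ Finset.prod_nonneg fun f _ => by positivity
  have ht1 : ∀ r ∈ orbitReps F n, t r ≤ 7 / 8 := fun r hr =>
    ht r ▸ prod_orbit_le hu0 hxu (mem_orbitReps.1 hr).1
  have ht2 : ∀ r ∈ orbitReps F n, t r ≤ 9 / 4 * u ^ (orbitPoly r).natDegree := fun r hr =>
    ht r ▸ prod_orbit_le_mul_pow hu0 (mem_orbitReps.1 hr).1
  have hpow : ∀ p : ↥(orbitReps F n) × Fin n, t p.1 ^ ((p.2 : ℕ) + 1) ≤ 7 / 8 := fun p =>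
    (pow_le_of_le_one (ht0 _) ((ht1 _ p.1.2).trans (by norm_num)) (Nat.succ_ne_zero _)).trans
      (ht1 _ p.1.2)
  have hinj : Function.Injective fun μ : T => partCounts n μ.1 := fun μ ν h =>
    Subtype.ext (partCounts_injOn hn (hT μ.2) (hT ν.2) h)
  have hcount : ∀ (μ : T) (p : ↥(orbitReps F n) × Fin n), partCounts n μ.1 p ≤ n := fun μ p =>
    (Multiset.count_le_card _ _).trans
      ((μ.1 p.1).2.card_parts_le.trans (XSet.size_le hn (hT μ.2).1 _))
  have hweight : ∀ μ : T, (3 / 2) ^ K * u ^ n ≤ ∏ p : ↥(orbitReps F n) × Fin n,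
      (t p.1 ^ ((p.2 : ℕ) + 1)) ^ partCounts n μ.1 p := by
    intro μ
    simp only [ht]
    rw [prod_pow_partCounts hn (hT μ.2) (3 / 2) u]
    have h := pow_le_pow_right₀ (by norm_num : (1 : ℝ) ≤ 3 / 2) (hK μ.1 μ.2)
    exact mul_le_mul_of_nonneg_right h (by positivity)
  refine (natCard_mul_le_prod_inv n (fun p => t p.1 ^ ((p.2 : ℕ) + 1))
    (fun p => pow_nonneg (ht0 _) _) (fun p => (hpow p).trans_lt (by norm_num))
    (fun μ : T => partCounts n μ.1) hinj hcount _ hweight).trans ?_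
  rw [Fintype.prod_prod_type]
  calc _ ≤ ∏ r : ↥(orbitReps F n), Real.exp (64 * t r) :=
        Finset.prod_le_prod
          (fun r _ => Finset.prod_nonneg fun i _ =>
            inv_nonneg.2 (by linarith [hpow (r, i)]))
          fun r _ => prod_one_sub_pow_inv_le n (ht0 r) (ht1 r r.2)
    _ = Real.exp (∑ r ∈ orbitReps F n, 64 * t r) := by
        rw [← Real.exp_sum]
        exact congrArg _ (Finset.sum_coe_sort (orbitReps F n) fun r => 64 * t r)
    _ ≤ _ := by
        refine Real.exp_le_exp.2 ?_
        rw [Finset.mul_sum]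
        refine Finset.sum_le_sum fun r hr => ?_
        have := ht2 r hr
        linarith

end Encoding

section LowerBound

open Polynomial UniqueFactorizationMonoid Classical

variable {F : Type} [Field F]

/-- The palindromic polynomial of degree `n` with constant term `1` and the given next
coefficients. -/
noncomputable def palindrome (n : ℕ) (a : Fin (n / 2) → F) : F[X] :=
  ∑ i ∈ Finset.range (n + 1),
    C (if h : 0 < min i (n - i) then a ⟨min i (n - i) - 1, by omega⟩ else 1) * X ^ i

theorem coeff_palindrome {n i : ℕ} (hi : i ≤ n) (a : Fin (n / 2) → F) :
    (palindrome n a).coeff i =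
      if h : 0 < min i (n - i) then a ⟨min i (n - i) - 1, by omega⟩ else 1 := by
  rw [palindrome, finsetSum_coeff]
  simp only [coeff_C_mul_X_pow]
  rw [Finset.sum_ite_eq, if_pos (Finset.mem_range.2 (by omega))]

theorem natDegree_palindrome (n : ℕ) (a : Fin (n / 2) → F) : (palindrome n a).natDegree = n := by
  refine natDegree_eq_of_le_of_coeff_ne_zero ?_ ?_
  · refine natDegree_sum_le_of_forall_le _ _ fun i hi => (natDegree_C_mul_X_pow_le _ _).trans ?_
    exact Nat.lt_succ_iff.1 (Finset.mem_range.1 hi)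
  · rw [coeff_palindrome le_rfl]
    simp

theorem coeff_zero_palindrome (n : ℕ) (a : Fin (n / 2) → F) : (palindrome n a).coeff 0 = 1 := by
  rw [coeff_palindrome (Nat.zero_le n)]
  simp

theorem monic_palindrome (n : ℕ) (a : Fin (n / 2) → F) : (palindrome n a).Monic := by
  rw [Monic, leadingCoeff, natDegree_palindrome, coeff_palindrome le_rfl]
  simp

theorem fstar_palindrome (n : ℕ) (a : Fin (n / 2) → F) :
    fstar (palindrome n a) = palindrome n a := by
  have h0 : (palindrome n a).coeff 0 ≠ 0 := by simp [coeff_zero_palindrome]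
  ext i
  by_cases hi : i ≤ n
  · rw [coeff_fstar _ (by rwa [natDegree_palindrome]), coeff_zero_palindrome, inv_one, one_mul,
      natDegree_palindrome, coeff_palindrome (Nat.sub_le _ _), coeff_palindrome hi]
    simp only [Nat.sub_sub_self hi, min_comm (n - i) i]
  · rw [coeff_eq_zero_of_natDegree_lt (by rw [natDegree_fstar h0, natDegree_palindrome]; omega),
      coeff_eq_zero_of_natDegree_lt (by rw [natDegree_palindrome]; omega)]

theorem palindrome_injective (n : ℕ) :
    Function.Injective (palindrome n : (Fin (n / 2) → F) → F[X]) := by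
  intro a b h
  funext i
  have hi := i.2
  have hmin : min ((i : ℕ) + 1) (n - (i + 1)) = i + 1 := by omega
  have := congrArg (fun p => coeff p ((i : ℕ) + 1)) h
  simp only [coeff_palindrome (show (i : ℕ) + 1 ≤ n by omega), hmin] at this
  simpa using this

/-- The element of `𝔛_n` which attaches to `f` a one-part partition whose size is the
multiplicity of `f` in `g`. -/
noncomputable def factorMultiplicities (g : F[X]) (f : F[X]) : Σ m : ℕ, Nat.Partition m :=
  if f ∈ PhiSet F then ⟨(normalizedFactors g).count f, Nat.Partition.indiscrete _⟩ else emptyPart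

theorem prod_normalizedFactors_of_monic {g : F[X]} (hg : g.Monic) :
    (normalizedFactors g).prod = g := by
  rw [prod_normalizedFactors_eq hg.ne_zero, hg.normalize_eq_self]

theorem mem_PhiSet_of_mem_normalizedFactors {f g : F[X]} (hg : g.coeff 0 ≠ 0)
    (hf : f ∈ normalizedFactors g) : f ∈ PhiSet F := by
  have hirr := irreducible_of_normalized_factor f hf
  refine ⟨?_, hirr, ?_⟩
  · have := normalize_normalized_factor f hf
    rw [← this]
    exact monic_normalize hirr.ne_zero
  · rintro rfl
    exact hg (X_dvd_iff.1 (dvd_of_mem_normalizedFactors hf))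

theorem size_factorMultiplicities {g : F[X]} (hg : g.coeff 0 ≠ 0) (f : F[X]) :
    (factorMultiplicities g f).1 = (normalizedFactors g).count f := by
  rw [factorMultiplicities]
  split_ifs with h
  · rfl
  · exact (Multiset.count_eq_zero.2 fun h' => h (mem_PhiSet_of_mem_normalizedFactors hg h')).symm

/-- `fstar` as a monoid homomorphism. -/
noncomputable def fstarHom (F : Type) [Field F] : F[X] →* F[X] where
  toFun := fstar
  map_one' := fstar_one
  map_mul' := fstar_mul

theorem map_fstar_normalizedFactors {g : F[X]} (hg : g.Monic) (h0 : g.coeff 0 ≠ 0)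
    (hs : fstar g = g) : (normalizedFactors g).map fstar = normalizedFactors g := by
  have hmem : ∀ f ∈ (normalizedFactors g).map fstar, f ∈ PhiSet F := by
    intro f hf
    obtain ⟨f', hf', rfl⟩ := Multiset.mem_map.1 hf
    exact PhiSet.fstar_mem (mem_PhiSet_of_mem_normalizedFactors h0 hf')
  have hprod : ((normalizedFactors g).map fstar).prod = g := by
    have := (fstarHom F).map_multiset_prod (normalizedFactors g)
    rw [prod_normalizedFactors_of_monic hg] at this
    exact this.symm.trans hs
  have h := normalizedFactors_prod_eq ((normalizedFactors g).map fstar)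
    fun f hf => (hmem f hf).2.1
  rw [hprod] at h
  nth_rewrite 2 [h]
  conv_lhs => rw [← Multiset.map_id ((normalizedFactors g).map fstar)]
  exact Multiset.map_congr rfl fun f hf => ((hmem f hf).1.normalize_eq_self).symm

theorem factorMultiplicities_mem_YSet {g : F[X]} (hg : g.Monic) (h0 : g.coeff 0 ≠ 0)
    (hs : fstar g = g) : factorMultiplicities g ∈ YSet F g.natDegree := by
  refine ⟨⟨fun f hf => if_neg hf, ?_⟩, fun f hf => ?_⟩
  · simp only [size_factorMultiplicities h0]
    rw [finsum_eq_sum_of_support_subset (s := (normalizedFactors g).toFinset)]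
    · conv_rhs => rw [← prod_normalizedFactors_of_monic hg]
      rw [natDegree_multiset_prod_of_monic _
        fun f hf => (mem_PhiSet_of_mem_normalizedFactors h0 hf).1,
        Finset.sum_multiset_map_count]
      simp only [smul_eq_mul, mul_comm]
    · intro f hf
      have : (normalizedFactors g).count f ≠ 0 := fun h => hf (by simp [h])
      exact Multiset.mem_toFinset.2 (Multiset.count_ne_zero.1 this)
  · have hcount : (normalizedFactors g).count (fstar f) = (normalizedFactors g).count f := by
      have key : ∀ f ∈ PhiSet F,
          (normalizedFactors g).count f ≤ (normalizedFactors g).count (fstar f) := by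
        intro f _
        nth_rewrite 2 [← map_fstar_normalizedFactors hg h0 hs]
        rw [Multiset.le_count_iff_replicate_le, ← Multiset.map_replicate]
        exact Multiset.map_le_map (Multiset.le_count_iff_replicate_le.1 le_rfl)
      refine le_antisymm ?_ (key f hf)
      simpa [PhiSet.fstar_fstar hf] using key _ (PhiSet.fstar_mem hf)
    rw [factorMultiplicities, factorMultiplicities, if_pos hf, if_pos (PhiSet.fstar_mem hf),
      hcount]

theorem eq_of_factorMultiplicities_eq {g h : F[X]} (hg : g.Monic) (hh : h.Monic)
    (hg0 : g.coeff 0 ≠ 0) (hh0 : h.coeff 0 ≠ 0)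
    (heq : factorMultiplicities g = factorMultiplicities h) : g = h := by
  rw [← prod_normalizedFactors_of_monic hg, ← prod_normalizedFactors_of_monic hh]
  congr 1
  ext f
  rw [← size_factorMultiplicities hg0, ← size_factorMultiplicities hh0, heq]

theorem natCard_pow_le_natCard_YSet (n : ℕ) (hfin : Finite (YSet F n)) :
    Nat.card F ^ (n / 2) ≤ Nat.card (YSet F n) := by
  have h1 : ∀ a : Fin (n / 2) → F, (palindrome n a).coeff 0 ≠ 0 := fun a => by
    simp [coeff_zero_palindrome]
  have hmem : ∀ a : Fin (n / 2) → F, factorMultiplicities (palindrome n a) ∈ YSet F n := by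
    intro a
    have := factorMultiplicities_mem_YSet (monic_palindrome n a) (h1 a) (fstar_palindrome n a)
    rwa [natDegree_palindrome] at this
  have := Nat.card_le_card_of_injective
    (fun a : Fin (n / 2) → F => (⟨_, hmem a⟩ : YSet F n)) fun a b h =>
      palindrome_injective n (eq_of_factorMultiplicities_eq (monic_palindrome n a)
        (monic_palindrome n b) (h1 a) (h1 b) (congrArg Subtype.val h))
  rwa [Nat.card_fun, Nat.card_fin] at this

end LowerBound

section DegreeValuation

open Polynomial

variable {F : Type} [Field F] [Finite F] {n : ℕ} {μ : F[X] → Σ m : ℕ, Nat.Partition m}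

theorem le_padicValRat_degGL {q : ℕ} (hq : Odd q) (hq1 : 1 < q) (hn : n ≠ 0)
    (hμ : μ ∈ XSet F n) :
    (n : ℤ) - (numFactors n μ *
      (padicValNat 2 (q + 1) + padicValNat 2 (q - 1) + (Nat.log 2 n + 2)) : ℕ) ≤
        padicValRat 2 (degGL q n μ) := by
  set B := padicValNat 2 (q + 1) + padicValNat 2 (q - 1) with hB
  have hne : ∀ m ≠ 0, (q : ℚ) ^ m - 1 ≠ 0 := by
    intro m hm
    have : (1 : ℚ) < (q : ℚ) ^ m := one_lt_pow₀ (by exact_mod_cast hq1) hm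
    linarith
  have hq0 : (q : ℚ) ≠ 0 := by
    have : q ≠ 0 := by omega
    exact_mod_cast this
  have hqv : padicValRat 2 (q : ℚ) = 0 := by
    rw [padicValRat.of_nat, padicValNat.eq_zero_of_not_dvd]
    · rfl
    · simpa [← even_iff_two_dvd] using hq
  have hden : ∀ f ∈ PhiFin F n,
      ((hookLengths (μ f).2).map fun h => (q : ℚ) ^ (f.natDegree * h) - 1).prod ≠ 0 ∧
      padicValRat 2 ((hookLengths (μ f).2).map fun h => (q : ℚ) ^ (f.natDegree * h) - 1).prod ≤
        ((μ f).1 * (B + (Nat.log 2 n + 2)) : ℕ) := by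
    intro f hf
    have hd := PhiSet.natDegree_pos (mem_PhiFin.1 hf).1
    have hpos : ∀ h ∈ hookLengths (μ f).2, f.natDegree * h ≠ 0 := fun h hh =>
      Nat.mul_ne_zero hd.ne' (by have := (mem_hookLengths _ hh).1; omega)
    have := padicValRat_multisetProd_le 2
      ((hookLengths (μ f).2).map fun h => (q : ℚ) ^ (f.natDegree * h) - 1)
      (B + (Nat.log 2 n + 2)) ?_ ?_
    · rwa [Multiset.card_map, card_hookLengths] at this
    · intro a ha
      obtain ⟨h, hh, rfl⟩ := Multiset.mem_map.1 ha
      exact hne _ (hpos h hh)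
    · intro a ha
      obtain ⟨h, hh, rfl⟩ := Multiset.mem_map.1 ha
      refine (padicValRat_two_pow_sub_one_le hq hq1 (hpos h hh)).trans ?_
      have h1 : f.natDegree * h ≤ n * 2 ^ 2 := by
        have h2 := XSet.natDegree_mul_le hn hμ f
        have h3 := Nat.mul_le_mul_left f.natDegree (mem_hookLengths _ hh).2
        nlinarith
      have h4 : Nat.log 2 (f.natDegree * h) ≤ Nat.log 2 n + 2 := by
        refine (Nat.log_mono_right h1).trans_eq ?_
        rw [pow_two, ← mul_assoc, Nat.log_mul_base (by norm_num) (by omega),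
          Nat.log_mul_base (by norm_num) hn]
      exact_mod_cast Nat.add_le_add_left h4 B
  have hfac : ∀ f ∈ PhiFin F n, (q : ℚ) ^ (f.natDegree * alphaP (μ f).2) /
      ((hookLengths (μ f).2).map fun h => (q : ℚ) ^ (f.natDegree * h) - 1).prod ≠ 0 := fun f hf =>
    div_ne_zero (pow_ne_zero _ hq0) (hden f hf).1
  have hnum : ∀ i ∈ Finset.Icc 1 n, (q : ℚ) ^ i - 1 ≠ 0 := fun i hi =>
    hne i (by have := Finset.mem_Icc.1 hi; omega)
  rw [degGL, finprod_eq_prod_of_mulSupport_subset (s := PhiFin F n),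
    padicValRat.mul (Finset.prod_ne_zero_iff.2 hnum) (Finset.prod_ne_zero_iff.2 hfac),
    padicValRat_finsetProd _ _ _ hnum, padicValRat_finsetProd _ _ _ hfac]
  · have h1 : (n : ℤ) ≤ ∑ i ∈ Finset.Icc 1 n, padicValRat 2 ((q : ℚ) ^ i - 1) := by
      calc (n : ℤ) = ∑ i ∈ Finset.Icc 1 n, 1 := by simp
        _ ≤ _ := Finset.sum_le_sum fun i hi =>
          one_le_padicValRat_two_pow_sub_one hq hq1 (by have := Finset.mem_Icc.1 hi; omega)
    have h2 : -((numFactors n μ * (B + (Nat.log 2 n + 2)) : ℕ) : ℤ) ≤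
        ∑ f ∈ PhiFin F n, padicValRat 2 ((q : ℚ) ^ (f.natDegree * alphaP (μ f).2) /
          ((hookLengths (μ f).2).map fun h => (q : ℚ) ^ (f.natDegree * h) - 1).prod) := by
      rw [numFactors, Finset.sum_mul, Nat.cast_sum, ← Finset.sum_neg_distrib]
      refine Finset.sum_le_sum fun f hf => ?_
      rw [padicValRat.div (pow_ne_zero _ hq0) (hden f hf).1, padicValRat.pow, hqv]
      have := (hden f hf).2
      linarith
    linarith
  · intro f hf
    by_contra h
    refine hf ?_
    dsimp only
    rw [XSet.eq_emptyPart_of_notMem hn hμ h]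
    have h1 : hookLengths emptyPart.2 = 0 := Multiset.card_eq_zero.1 (card_hookLengths _)
    rw [h1]
    simp [alphaP, emptyPart]

theorem le_numFactors_of_padicValRat_degGL_lt {q k : ℕ} (hq : Odd q) (hq1 : 1 < q) (hn : n ≠ 0)
    (hμ : μ ∈ XSet F n)
    (h : padicValRat 2 (degGL q n μ) < (padicValNat 2 (n.descFactorial k) : ℤ)) :
    n / (padicValNat 2 (q + 1) + padicValNat 2 (q - 1) + (Nat.log 2 n + 2)) - k ≤
      numFactors n μ := by
  have h1 := le_padicValRat_degGL hq hq1 hn hμ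
  have h2 := padicValNat_descFactorial_le n k
  set B := padicValNat 2 (q + 1) + padicValNat 2 (q - 1)
  have h3 : n < numFactors n μ * (B + (Nat.log 2 n + 2)) + k * (Nat.log 2 n + 1) := by omega
  have h4 : n ≤ (numFactors n μ + k) * (B + (Nat.log 2 n + 2)) := by nlinarith
  have h5 := Nat.div_le_of_le_mul (h4.trans_eq (mul_comm _ _))
  omega

end DegreeValuation

section Asymptotics

theorem eventually_add_natLog_le (c : ℕ) {ε : ℝ} (hε : 0 < ε) :
    ∀ᶠ n : ℕ in atTop, ((c + Nat.log 2 n : ℕ) : ℝ) ≤ ε * √(n : ℝ) := by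
  have h1 : (fun x : ℝ => c + Real.log x / Real.log 2) =o[atTop] fun x : ℝ => x ^ (1 / 2 : ℝ) := by
    refine Asymptotics.IsLittleO.add ?_ ?_
    · refine Asymptotics.isLittleO_const_left.2 (Or.inr ?_)
      exact tendsto_norm_atTop_atTop.comp (tendsto_rpow_atTop (by norm_num))
    · simp only [div_eq_inv_mul]
      exact (isLittleO_log_rpow_atTop (by norm_num)).const_mul_left _
  filter_upwards [tendsto_natCast_atTop_atTop.eventually (h1.def hε)] with n hn
  rw [Real.norm_of_nonneg (by positivity : (0 : ℝ) ≤ (n : ℝ) ^ (1 / 2 : ℝ)),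
    ← Real.sqrt_eq_rpow] at hn
  refine le_trans ?_ ((le_abs_self _).trans hn)
  push_cast
  gcongr
  exact Real.natLog_le_logb n 2

theorem tendsto_exp_sqrt_mul_inv_pow (A Q : ℝ) (hQ : 0 ≤ Q) (c k : ℕ) :
    Tendsto (fun n : ℕ => A * (Real.exp (144 * √(2 * ((4 * n + 1) * Q))) *
      ((3 / 2 : ℝ) ^ (n / (c + Nat.log 2 n) - k))⁻¹)) atTop (𝓝 0) := by
  rw [← mul_zero A]
  refine Tendsto.const_mul A ?_
  set b := Real.log (3 / 2) with hb
  have hb0 : 0 < b := Real.log_pos (by norm_num)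
  set a := 144 * √(10 * Q) with ha
  have ha0 : 0 ≤ a := by positivity
  have hlim : Tendsto (fun n : ℕ => Real.exp (b * (k + 1)) * Real.exp (-√(n : ℝ))) atTop (𝓝 0) := by
    rw [← mul_zero (Real.exp (b * (k + 1)))]
    exact (Real.tendsto_exp_neg_atTop_nhds_zero.comp
      (Real.tendsto_sqrt_atTop.comp tendsto_natCast_atTop_atTop)).const_mul _
  refine squeeze_zero' (Eventually.of_forall fun n => by positivity) ?_ hlim
  filter_upwards [eventually_add_natLog_le c (ε := b / (a + 1)) (by positivity),
    eventually_ge_atTop 2] with n hn hn2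
  have hn1 : (1 : ℝ) ≤ n := by exact_mod_cast (by omega : 1 ≤ n)
  have hs0 : 0 < √(n : ℝ) := Real.sqrt_pos.2 (by linarith)
  have hlog : 0 < Nat.log 2 n := Nat.log_pos (by norm_num) hn2
  set m := c + Nat.log 2 n with hm
  have hm0 : (0 : ℝ) < m := by exact_mod_cast (by omega : 0 < m)
  have h1 : 144 * √(2 * ((4 * n + 1) * Q)) ≤ a * √(n : ℝ) := by
    rw [ha, mul_assoc, ← Real.sqrt_mul (by positivity)]
    refine mul_le_mul_of_nonneg_left (Real.sqrt_le_sqrt ?_) (by norm_num)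
    nlinarith [mul_nonneg hQ (sub_nonneg.2 hn1)]
  have h2 : (a + 1) * √(n : ℝ) ≤ b * (n / m) := by
    rw [← mul_div_assoc, le_div_iff₀ hm0]
    calc (a + 1) * √(n : ℝ) * m ≤ (a + 1) * √(n : ℝ) * (b / (a + 1) * √(n : ℝ)) := by gcongr
      _ = b * (√(n : ℝ) * √(n : ℝ)) := by field_simp
      _ = b * n := by rw [Real.mul_self_sqrt (by positivity)]
  have h3 : (n : ℝ) / m - 1 - k ≤ (n / m - k : ℕ) := by
    have h4 := (Nat.lt_floor_add_one ((n : ℝ) / m)).le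
    rw [Nat.floor_div_natCast, Nat.floor_natCast] at h4
    have h5 : ((n / m : ℕ) : ℝ) ≤ (n / m - k : ℕ) + k := by
      exact_mod_cast (by omega : n / m ≤ (n / m - k) + k)
    linarith
  have h6 : ((3 / 2 : ℝ) ^ (n / m - k))⁻¹ = Real.exp (-(b * (n / m - k : ℕ))) := by
    rw [Real.exp_neg, mul_comm b, Real.exp_nat_mul, hb, Real.exp_log (by norm_num)]
  rw [h6, ← Real.exp_add, ← Real.exp_add]
  refine Real.exp_le_exp.2 ?_
  nlinarith

end Asymptotics

section Ratio

open Polynomial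

variable {F : Type} [Field F] [Finite F]

theorem natCard_div_natCard_YSet_le {n : ℕ} (hn : n ≠ 0) (hF : 3 ≤ Nat.card F)
    (T : Set (F[X] → Σ m : ℕ, Nat.Partition m)) (hT : T ⊆ YSet F n) (K : ℕ)
    (hK : ∀ μ ∈ T, K ≤ numFactors n μ) :
    (Nat.card T : ℝ) / Nat.card (YSet F n) ≤
      √(Nat.card F : ℝ) * (Real.exp (144 * √(2 * ((4 * n + 1) * Nat.card F))) *
        ((3 / 2 : ℝ) ^ K)⁻¹) := by
  by_cases hfin : Finite (YSet F n)
  swap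
  · have : Infinite (YSet F n) := not_finite_iff_infinite.1 hfin
    rw [Nat.card_eq_zero_of_infinite (α := YSet F n), Nat.cast_zero, div_zero]
    positivity
  have hY : (Nat.card F : ℝ) ^ (n / 2) ≤ Nat.card (YSet F n) := by
    exact_mod_cast natCard_pow_le_natCard_YSet n hfin
  set Q : ℝ := (Nat.card F : ℝ) with hQ
  have hQ3 : (3 : ℝ) ≤ Q := by rw [hQ]; exact_mod_cast hF
  set s := √Q with hs
  have hs1 : 1 ≤ s := Real.one_le_sqrt.2 (by linarith)
  have hss : s * s = Q := Real.mul_self_sqrt (by linarith)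
  have hu : s⁻¹ ^ 2 * Q = 1 := by
    rw [← hss]; field_simp
  have hu0 : 0 ≤ s⁻¹ := by positivity
  have h1 := natCard_numFactors_ge_le hn hF hu0 hu T hT K hK
  have h2 : ∑ r ∈ orbitReps F n, s⁻¹ ^ (orbitPoly r).natDegree ≤ √(2 * ((4 * n + 1) * Q)) :=
    Real.le_sqrt_of_sq_le (sum_orbitReps_sq_le n hu0 hu (inv_le_one_of_one_le₀ hs1))
  have h3 : (Nat.card T : ℝ) * ((3 / 2) ^ K * s⁻¹ ^ n) ≤
      Real.exp (144 * √(2 * ((4 * n + 1) * Q))) :=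
    h1.trans (Real.exp_le_exp.2 (by linarith))
  have h4 : s ^ n ≤ s * Q ^ (n / 2) := by
    rw [← hss, ← pow_two, ← pow_mul, ← pow_succ']
    exact pow_le_pow_right₀ hs1 (by omega)
  have hQpos : 0 < Q ^ (n / 2) := by positivity
  refine (div_le_div_of_nonneg_left (by positivity) hQpos hY).trans ?_
  rw [div_le_iff₀ hQpos]
  set E := Real.exp (144 * √(2 * ((4 * n + 1) * Q)))
  have hspos : 0 < s := by linarith
  calc (Nat.card T : ℝ)
      = Nat.card T * ((3 / 2) ^ K * s⁻¹ ^ n) * (((3 / 2 : ℝ) ^ K)⁻¹ * s ^ n) := by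
        rw [inv_pow]; field_simp
    _ ≤ E * (((3 / 2 : ℝ) ^ K)⁻¹ * (s * Q ^ (n / 2))) := by gcongr
    _ = _ := by ring

end Ratio

/-- For a fixed odd prime power `q` and fixed `k ≥ 1`, the proportion of `μ ∈ 𝔜_n` with
`v₂(d_μ) < v₂((n)_k)` tends to `0` as `n → ∞`, where `(n)_k` is the falling factorial. -/
theorem stmt1 (q : ℕ) (hq : Odd q) (hqpp : IsPrimePow q)
    (F : Type) [Field F] [Fintype F] (hF : Fintype.card F = q)
    (k : ℕ) (hk : 1 ≤ k) :
    Filter.Tendsto (fun n : ℕ =>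
      (Nat.card {μ : Polynomial F → Σ m : ℕ, Nat.Partition m //
          μ ∈ YSet F n ∧
            padicValRat 2 (degGL q n μ) < (padicValNat 2 (n.descFactorial k) : ℤ)} : ℝ) /
        (Nat.card {μ : Polynomial F → Σ m : ℕ, Nat.Partition m // μ ∈ YSet F n} : ℝ))
      Filter.atTop (𝓝 0) := by
  have hcard : Nat.card F = q := by rw [Nat.card_eq_fintype_card, hF]
  have hq1 : 1 < q := hqpp.one_lt
  have hq3 : 3 ≤ Nat.card F := by
    obtain ⟨r, hr⟩ := hq
    omega
  refine squeeze_zero' (Eventually.of_forall fun n => by positivity) ?_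
    (tendsto_exp_sqrt_mul_inv_pow (√(Nat.card F : ℝ)) (Nat.card F) (by positivity)
      (padicValNat 2 (q + 1) + padicValNat 2 (q - 1) + 2) k)
  filter_upwards [eventually_ne_atTop 0] with n hn
  refine natCard_div_natCard_YSet_le hn hq3
    {μ | μ ∈ YSet F n ∧
      padicValRat 2 (degGL q n μ) < (padicValNat 2 (n.descFactorial k) : ℤ)}
    (fun μ hμ => hμ.1) _ fun μ hμ => ?_
  have := le_numFactors_of_padicValRat_degGL_lt hq hq1 hn hμ.1.1 hμ.2
  rwa [add_comm (Nat.log 2 n) 2, ← add_assoc] at this
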